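/- arXiv:2101.02502 — 8 statements merged into one kernel-verified Lean document; each statement's English description precedes it below -/
import Mathlib

section
/- Let r be a relation over schema R and let X, Y ⊆ R be disjoint. Then r satisfies the independence statement X ⊥ Y if and only if |r(X ∪ Y)| = |r(X)| · |r(Y)|, where |r(Z)| denotes the number of distinct restrictions of tuples of r to Z. -/
/-- A relation `r` (finite set of tuples) satisfies the independence statement `X ⊥ Y`. -/
def Satisfies {α β : Type*} (r : Finset (α → β)) (X Y : Finset α) : Prop :=
  ∀ t₁ ∈ r, ∀ t₂ ∈ r, ∃ t ∈ r, (∀ a ∈ X, t a = t₁ a) ∧ (∀ a ∈ Y, t a = t₂ a)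

/-- The projection of a relation onto a set of attributes: the finite set of
restrictions of its tuples to `X`. -/
def proj {α β : Type*} [DecidableEq α] [DecidableEq β]
    (r : Finset (α → β)) (X : Finset α) : Finset ({a // a ∈ X} → β) :=
  r.image (fun t a => t a.1)

/-- Restricts a tuple over `X ∪ Y` to the pair of its restrictions to `X` and to `Y`. -/
def splitUnion {α β : Type*} [DecidableEq α] (X Y : Finset α)
    (f : {a // a ∈ X ∪ Y} → β) : ({a // a ∈ X} → β) × ({a // a ∈ Y} → β) :=
  (fun a => f ⟨a.1, Finset.mem_union_left Y a.2⟩,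
    fun a => f ⟨a.1, Finset.mem_union_right X a.2⟩)

theorem splitUnion_injective {α β : Type*} [DecidableEq α] (X Y : Finset α) :
    Function.Injective (splitUnion (β := β) X Y) := by
  intro f g h
  obtain ⟨hX, hY⟩ := Prod.ext_iff.mp h
  funext ⟨a, ha⟩
  rcases Finset.mem_union.mp ha with haX | haY
  · exact congrFun hX ⟨a, haX⟩
  · exact congrFun hY ⟨a, haY⟩

theorem image_splitUnion_proj_subset {α β : Type*} [DecidableEq α] [DecidableEq β]
    (r : Finset (α → β)) (X Y : Finset α) :
    (proj r (X ∪ Y)).image (splitUnion X Y) ⊆ proj r X ×ˢ proj r Y := by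
  intro p hp
  obtain ⟨f, hf, rfl⟩ := Finset.mem_image.mp hp
  obtain ⟨t, ht, rfl⟩ := Finset.mem_image.mp hf
  exact Finset.mem_product.mpr
    ⟨Finset.mem_image.mpr ⟨t, ht, rfl⟩, Finset.mem_image.mpr ⟨t, ht, rfl⟩⟩

theorem satisfies_iff_product_subset {α β : Type*} [DecidableEq α] [DecidableEq β]
    (r : Finset (α → β)) (X Y : Finset α) :
    Satisfies r X Y ↔ proj r X ×ˢ proj r Y ⊆ (proj r (X ∪ Y)).image (splitUnion X Y) := by
  constructor
  · rintro h ⟨f, g⟩ hp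
    obtain ⟨hf, hg⟩ := Finset.mem_product.mp hp
    obtain ⟨t₁, ht₁, rfl⟩ := Finset.mem_image.mp hf
    obtain ⟨t₂, ht₂, rfl⟩ := Finset.mem_image.mp hg
    obtain ⟨t, ht, hX, hY⟩ := h t₁ ht₁ t₂ ht₂
    exact Finset.mem_image.mpr ⟨_, Finset.mem_image.mpr ⟨t, ht, rfl⟩,
      Prod.ext (funext fun a => hX a.1 a.2) (funext fun a => hY a.1 a.2)⟩
  · intro h t₁ ht₁ t₂ ht₂
    have hp : ((fun a => t₁ a.1, fun a => t₂ a.1) :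
        ({a // a ∈ X} → β) × ({a // a ∈ Y} → β)) ∈ proj r X ×ˢ proj r Y :=
      Finset.mem_product.mpr
        ⟨Finset.mem_image.mpr ⟨t₁, ht₁, rfl⟩, Finset.mem_image.mpr ⟨t₂, ht₂, rfl⟩⟩
    obtain ⟨f, hf, hfe⟩ := Finset.mem_image.mp (h hp)
    obtain ⟨t, ht, rfl⟩ := Finset.mem_image.mp hf
    obtain ⟨hX, hY⟩ := Prod.ext_iff.mp hfe
    exact ⟨t, ht, fun a ha => congrFun hX ⟨a, ha⟩, fun a ha => congrFun hY ⟨a, ha⟩⟩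

theorem stmt2 {α β : Type*} [DecidableEq α] [DecidableEq β]
    (R : Finset α) (r : Finset (α → β)) (X Y : Finset α)
    (hX : X ⊆ R) (hY : Y ⊆ R) (hdisj : Disjoint X Y) :
    Satisfies r X Y ↔ (proj r (X ∪ Y)).card = (proj r X).card * (proj r Y).card := by
  rw [satisfies_iff_product_subset, ← Finset.card_product,
    ← Finset.card_image_of_injective _ (splitUnion_injective X Y)]
  have hsub := image_splitUnion_proj_subset r X Y
  exact ⟨fun h => congrArg Finset.card (hsub.antisymm h),
    fun h => (Finset.eq_of_subset_of_card_le hsub h.ge).ge⟩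
end

section
/- Let G = (V, E) be a finite simple graph and let r be the relation over schema V consisting of: for each edge {u, v} ∈ E, the tuple mapping u and v to 1 and every other vertex-attribute to 0; for each vertex u ∈ V, the tuple mapping u to 1 and every other vertex-attribute to 0; and the all-zero tuple. Then for all nonempty V₁, V₂ ⊆ V: r satisfies the independence statement V₁ ⊥ V₂ if and only if V₁ and V₂ are disjoint, every u ∈ V₁ is adjacent to every v ∈ V₂, and no two vertices within V₁ are adjacent and no two vertices within V₂ are adjacent (i.e., V₁ and V₂ induce a node biclique in G). -/
/-- The relation built from a finite graph `G`: a tuple for each edge (mapping its two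
endpoints to `1` and everything else to `0`), a tuple for each vertex (mapping it to `1`
and everything else to `0`), and the all-zero tuple. -/
def graphRel {V : Type*} [Fintype V] [DecidableEq V]
    (G : SimpleGraph V) [DecidableRel G.Adj] : Finset (V → ℕ) :=
  (G.edgeFinset.image (fun e a => if a ∈ e then 1 else 0)) ∪
  (Finset.univ.image (fun u a => if a = u then 1 else 0)) ∪
  {fun _ => 0}

theorem mem_graphRel {V : Type*} [Fintype V] [DecidableEq V]
    (G : SimpleGraph V) [DecidableRel G.Adj] (t : V → ℕ) :
    t ∈ graphRel G ↔
      (∃ u v, G.Adj u v ∧ ∀ a, t a = if a = u ∨ a = v then 1 else 0) ∨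
      (∃ u, ∀ a, t a = if a = u then 1 else 0) ∨ ∀ a, t a = 0 := by
  simp only [graphRel, Finset.mem_union, Finset.mem_image, Finset.mem_singleton,
    Finset.mem_univ, true_and, SimpleGraph.mem_edgeFinset, or_assoc, Sym2.exists,
    SimpleGraph.mem_edgeSet, Sym2.mem_iff, funext_iff, eq_comm (b := t _)]

theorem Satisfies.symm {α β : Type*} {r : Finset (α → β)} {X Y : Finset α}
    (h : Satisfies r X Y) : Satisfies r Y X := fun t₁ ht₁ t₂ ht₂ =>
  let ⟨t, ht, hX, hY⟩ := h t₂ ht₂ t₁ ht₁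
  ⟨t, ht, hY, hX⟩

theorem vertex_mem_graphRel {V : Type*} [Fintype V] [DecidableEq V]
    (G : SimpleGraph V) [DecidableRel G.Adj] (u : V) :
    (fun a => if a = u then 1 else 0) ∈ graphRel G :=
  (mem_graphRel G _).2 (.inr (.inl ⟨u, fun _ => rfl⟩))

theorem edge_mem_graphRel {V : Type*} [Fintype V] [DecidableEq V]
    {G : SimpleGraph V} [DecidableRel G.Adj] {u v : V} (h : G.Adj u v) :
    (fun a => if a = u ∨ a = v then 1 else 0) ∈ graphRel G :=
  (mem_graphRel G _).2 (.inl ⟨u, v, h, fun _ => rfl⟩)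

theorem zero_mem_graphRel {V : Type*} [Fintype V] [DecidableEq V]
    (G : SimpleGraph V) [DecidableRel G.Adj] : (fun _ => 0) ∈ graphRel G :=
  (mem_graphRel G _).2 (.inr (.inr fun _ => rfl))

theorem Satisfies.disjoint_of_graphRel {V : Type*} [Fintype V] [DecidableEq V]
    {G : SimpleGraph V} [DecidableRel G.Adj] {X Y : Finset V}
    (h : Satisfies (graphRel G) X Y) : Disjoint X Y := by
  refine Finset.disjoint_left.2 fun w hX hY => ?_
  obtain ⟨t, -, h₁, h₂⟩ := h _ (vertex_mem_graphRel G w) _ (zero_mem_graphRel G)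
  have := h₁ w hX
  have := h₂ w hY
  simp_all

theorem Satisfies.adj_of_graphRel {V : Type*} [Fintype V] [DecidableEq V]
    {G : SimpleGraph V} [DecidableRel G.Adj] {X Y : Finset V}
    (h : Satisfies (graphRel G) X Y) {u v : V} (hu : u ∈ X) (hv : v ∈ Y) : G.Adj u v := by
  have hne : u ≠ v := fun e => Finset.disjoint_left.1 h.disjoint_of_graphRel hu (e ▸ hv)
  obtain ⟨t, ht, h₁, h₂⟩ := h _ (vertex_mem_graphRel G u) _ (vertex_mem_graphRel G v)
  have := h₁ u hu
  have := h₂ v hv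
  rw [mem_graphRel] at ht
  grind [SimpleGraph.Adj.symm]

theorem Satisfies.not_adj_of_graphRel {V : Type*} [Fintype V] [DecidableEq V]
    {G : SimpleGraph V} [DecidableRel G.Adj] {X Y : Finset V}
    (h : Satisfies (graphRel G) X Y) (hY : Y.Nonempty) {u v : V} (hu : u ∈ X) (hv : v ∈ X) :
    ¬ G.Adj u v := by
  intro huv
  obtain ⟨w, hw⟩ := hY
  have := huv.ne
  have := (h.adj_of_graphRel hu hw).ne
  have := (h.adj_of_graphRel hv hw).ne
  obtain ⟨t, ht, h₁, h₂⟩ := h _ (edge_mem_graphRel huv) _ (vertex_mem_graphRel G w)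
  have := h₁ u hu
  have := h₁ v hv
  have := h₂ w hw
  rw [mem_graphRel] at ht
  grind

/-- On an independent set, every tuple of `graphRel G` is zero or the indicator of a vertex. -/
theorem eq_zero_or_vertex_of_mem_graphRel {V : Type*} [Fintype V] [DecidableEq V]
    {G : SimpleGraph V} [DecidableRel G.Adj] {S : Finset V}
    (hS : ∀ u ∈ S, ∀ v ∈ S, ¬ G.Adj u v) {t : V → ℕ} (ht : t ∈ graphRel G) :
    (∀ a ∈ S, t a = 0) ∨ ∃ u ∈ S, ∀ a ∈ S, t a = if a = u then 1 else 0 := by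
  rw [mem_graphRel] at ht
  rcases ht with ⟨u, v, huv, ht⟩ | ⟨u, ht⟩ | ht
  · by_cases hu : u ∈ S
    · exact .inr ⟨u, hu, by grind⟩
    · by_cases hv : v ∈ S
      · exact .inr ⟨v, hv, by grind⟩
      · exact .inl (by grind)
  · by_cases hu : u ∈ S
    · exact .inr ⟨u, hu, by grind⟩
    · exact .inl (by grind)
  · exact .inl fun a _ => ht a

theorem stmt3 {V : Type*} [Fintype V] [DecidableEq V]
    (G : SimpleGraph V) [DecidableRel G.Adj]
    (V₁ V₂ : Finset V) (h₁ : V₁.Nonempty) (h₂ : V₂.Nonempty) :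
    Satisfies (graphRel G) V₁ V₂ ↔
      Disjoint V₁ V₂ ∧
      (∀ u ∈ V₁, ∀ v ∈ V₂, G.Adj u v) ∧
      (∀ u ∈ V₁, ∀ v ∈ V₁, ¬ G.Adj u v) ∧
      (∀ u ∈ V₂, ∀ v ∈ V₂, ¬ G.Adj u v) := by
  constructor
  · intro h
    exact ⟨h.disjoint_of_graphRel, fun u hu v hv => h.adj_of_graphRel hu hv,
      fun u hu v hv => h.not_adj_of_graphRel h₂ hu hv,
      fun u hu v hv => h.symm.not_adj_of_graphRel h₁ hu hv⟩
  · rintro ⟨hd, hadj, hi₁, hi₂⟩ t₁ ht₁ t₂ ht₂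
    rw [Finset.disjoint_left] at hd
    rcases eq_zero_or_vertex_of_mem_graphRel hi₁ ht₁ with e₁ | ⟨u, hu, e₁⟩ <;>
      rcases eq_zero_or_vertex_of_mem_graphRel hi₂ ht₂ with e₂ | ⟨v, hv, e₂⟩
    · exact ⟨_, zero_mem_graphRel G, by grind, by grind⟩
    · exact ⟨_, vertex_mem_graphRel G v, by grind, by grind⟩
    · exact ⟨_, vertex_mem_graphRel G u, by grind, by grind⟩
    · exact ⟨_, edge_mem_graphRel (hadj u hu v hv), by grind, by grind⟩
end

section
/- Let r be a nonempty relation over an index schema R ∪ {i} (i ∉ R), let 0 and 1 be two distinct values not appearing anywhere in r, and let k ≥ 1. Define the incremented relation r⁺ as r together with, for each value a in the projection r({i}), the tuple that maps every attribute of R to 0 and i to a, and the tuple that maps every attribute of R to 1 and i to a. Then r⁺ satisfies some non-trivial independence statement of arity k + 1 if and only if r satisfies X ⊥ {i} for some X ⊆ R with |X| = k. -/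
theorem Satisfies.mono {α β : Type*} {r : Finset (α → β)} {X Y X' Y' : Finset α}
    (h : Satisfies r X Y) (hX : X' ⊆ X) (hY : Y' ⊆ Y) : Satisfies r X' Y' := fun t₁ h₁ t₂ h₂ =>
  let ⟨t, ht, hX', hY'⟩ := h t₁ h₁ t₂ h₂
  ⟨t, ht, fun a ha => hX' a (hX ha), fun a ha => hY' a (hY ha)⟩

/-- The tuple that agrees with `t` at the index `i` and is constantly `v` elsewhere. -/
def constTuple {α β : Type*} [DecidableEq α] (i : α) (v : β) (t : α → β) : α → β :=
  fun a => if a = i then t i else v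

section Increment

variable {α β : Type*} [DecidableEq α] {R : Finset α} {i : α} {r r' : Finset (α → β)} {v₀ v₁ : β}

theorem constTuple_self (v : β) (t : α → β) : constTuple i v t i = t i := by
  simp [constTuple]

theorem constTuple_of_ne {a : α} (ha : a ≠ i) (v : β) (t : α → β) : constTuple i v t a = v := by
  simp [constTuple, ha]

/-- In the incremented relation `r'`, no independence statement has attributes of `R` on both
sides. -/
theorem not_satisfies_increment (hi : i ∉ R) (hr : r.Nonempty) (hv : v₀ ≠ v₁)
    (hfresh : ∀ t ∈ r, ∀ a ∈ R, t a ≠ v₀ ∧ t a ≠ v₁)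
    (hr' : ∀ t, t ∈ r' ↔ t ∈ r ∨ ∃ s ∈ r, constTuple i v₀ s = t ∨ constTuple i v₁ s = t)
    {X Y : Finset α} {a b : α} (ha : a ∈ X) (haR : a ∈ R) (hb : b ∈ Y) (hbR : b ∈ R) :
    ¬ Satisfies r' X Y := by
  intro h
  obtain ⟨s, hs⟩ := hr
  obtain ⟨t, ht, hX, hY⟩ := h (constTuple i v₀ s) ((hr' _).2 (.inr ⟨s, hs, .inl rfl⟩))
    (constTuple i v₁ s) ((hr' _).2 (.inr ⟨s, hs, .inr rfl⟩))
  have hai : a ≠ i := fun e => hi (e ▸ haR)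
  have hbi : b ≠ i := fun e => hi (e ▸ hbR)
  have hta := hX a ha
  have htb := hY b hb
  rw [constTuple_of_ne hai] at hta
  rw [constTuple_of_ne hbi] at htb
  rcases (hr' t).1 ht with ht | ⟨u, -, rfl | rfl⟩
  · exact (hfresh t ht a haR).1 hta
  · exact hv ((constTuple_of_ne hbi _ _).symm.trans htb)
  · exact hv (hta.symm.trans (constTuple_of_ne hai _ _))

/-- For nonempty `X ⊆ R`, the incremented relation `r'` satisfies `X ⊥ {i}` iff `r` does. -/
theorem satisfies_increment_singleton_iff (hi : i ∉ R)
    (hfresh : ∀ t ∈ r, ∀ a ∈ R, t a ≠ v₀ ∧ t a ≠ v₁)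
    (hr' : ∀ t, t ∈ r' ↔ t ∈ r ∨ ∃ s ∈ r, constTuple i v₀ s = t ∨ constTuple i v₁ s = t)
    {X : Finset α} (hXR : X ⊆ R) (hX : X.Nonempty) :
    Satisfies r' X {i} ↔ Satisfies r X {i} := by
  have hne : ∀ a ∈ X, a ≠ i := fun a ha e => hi (e ▸ hXR ha)
  constructor
  · intro h t₁ h₁ t₂ h₂
    obtain ⟨t, ht, htX, hti⟩ := h t₁ ((hr' _).2 (.inl h₁)) t₂ ((hr' _).2 (.inl h₂))
    obtain ⟨a, ha⟩ := hX
    have hta := htX a ha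
    rcases (hr' t).1 ht with ht | ⟨u, -, rfl | rfl⟩
    · exact ⟨t, ht, htX, hti⟩
    · rw [constTuple_of_ne (hne a ha)] at hta
      exact absurd hta.symm (hfresh t₁ h₁ a (hXR ha)).1
    · rw [constTuple_of_ne (hne a ha)] at hta
      exact absurd hta.symm (hfresh t₁ h₁ a (hXR ha)).2
  · intro h t₁ h₁ t₂ h₂
    obtain ⟨s₂, hs₂, hs₂i⟩ : ∃ s ∈ r, s i = t₂ i := by
      rcases (hr' t₂).1 h₂ with ht | ⟨u, hu, rfl | rfl⟩
      · exact ⟨t₂, ht, rfl⟩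
      all_goals exact ⟨u, hu, (constTuple_self _ _).symm⟩
    have hconst : ∀ v u, ∀ a ∈ X, constTuple i v s₂ a = constTuple i v u a := fun v u a ha => by
      rw [constTuple_of_ne (hne a ha), constTuple_of_ne (hne a ha)]
    have hindex : ∀ v, ∀ a ∈ ({i} : Finset α), constTuple i v s₂ a = t₂ a := fun v a ha => by
      rw [Finset.mem_singleton.1 ha, constTuple_self, hs₂i]
    rcases (hr' t₁).1 h₁ with ht | ⟨u, hu, rfl | rfl⟩
    · obtain ⟨t, ht, htX, hti⟩ := h t₁ ht s₂ hs₂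
      refine ⟨t, (hr' t).2 (.inl ht), htX, fun a ha => (hti a ha).trans ?_⟩
      rw [Finset.mem_singleton.1 ha, hs₂i]
    · exact ⟨_, (hr' _).2 (.inr ⟨s₂, hs₂, .inl rfl⟩), hconst _ _, hindex _⟩
    · exact ⟨_, (hr' _).2 (.inr ⟨s₂, hs₂, .inr rfl⟩), hconst _ _, hindex _⟩

end Increment

open Classical in
theorem stmt6 {α β : Type*} [DecidableEq α] [DecidableEq β]
    (R : Finset α) (i : α) (hi : i ∉ R)
    (r : Finset (α → β)) (hr : r.Nonempty)
    (v₀ v₁ : β) (hv : v₀ ≠ v₁)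
    (hfresh : ∀ t ∈ r, ∀ a ∈ insert i R, t a ≠ v₀ ∧ t a ≠ v₁)
    (k : ℕ) (hk : 1 ≤ k) :
    -- the incremented relation r⁺
    (∃ X Y : Finset α, X ⊆ insert i R ∧ Y ⊆ insert i R ∧
        X.Nonempty ∧ Y.Nonempty ∧ (X ∪ Y).card = k + 1 ∧
        Satisfies (r ∪ r.image (fun t a => if a = i then t i else v₀)
                     ∪ r.image (fun t a => if a = i then t i else v₁)) X Y) ↔
    (∃ X : Finset α, X ⊆ R ∧ X.card = k ∧ Satisfies r X {i}) := by
  have hfreshR : ∀ t ∈ r, ∀ a ∈ R, t a ≠ v₀ ∧ t a ≠ v₁ := fun t ht a ha =>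
    hfresh t ht a (Finset.mem_insert_of_mem ha)
  have hr' : ∀ t, t ∈ r ∪ r.image (fun t a => if a = i then t i else v₀)
        ∪ r.image (fun t a => if a = i then t i else v₁) ↔
      t ∈ r ∨ ∃ s ∈ r, constTuple i v₀ s = t ∨ constTuple i v₁ s = t := fun t => by
    simp only [Finset.mem_union, Finset.mem_image, or_assoc, ← exists_or, ← and_or_left]
    rfl
  generalize r ∪ r.image (fun t a => if a = i then t i else v₀)
    ∪ r.image (fun t a => if a = i then t i else v₁) = r' at hr' ⊢
  constructor
  · rintro ⟨X, Y, hX, hY, hXne, hYne, hcard, h⟩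
    -- By symmetry, it suffices to treat the case where `i` is the only attribute of `Y`.
    have key : ∀ X Y : Finset α, X ⊆ insert i R → Y.Nonempty → (X ∪ Y).card = k + 1 →
        Satisfies r' X Y → (∀ b ∈ Y, b = i) →
        ∃ X : Finset α, X ⊆ R ∧ X.card = k ∧ Satisfies r X {i} := by
      intro X Y hX hYne hcard h hYi
      obtain rfl : Y = {i} := Finset.eq_singleton_iff_nonempty_unique_mem.2 ⟨hYne, hYi⟩
      have hXR : X.erase i ⊆ R := Finset.subset_insert_iff.1 hX
      have hXk : (X.erase i).card = k := by
        have : X ∪ {i} = insert i (X.erase i) := by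
          ext a
          by_cases ha : a = i <;> simp [ha]
        rw [this, Finset.card_insert_of_notMem (Finset.notMem_erase i X)] at hcard
        omega
      exact ⟨X.erase i, hXR, hXk,
        (satisfies_increment_singleton_iff hi hfreshR hr' hXR (Finset.card_pos.1 (by omega))).1
          (h.mono (Finset.erase_subset _ _) subset_rfl)⟩
    by_cases hYi : ∀ b ∈ Y, b = i
    · exact key X Y hX hYne hcard h hYi
    by_cases hXi : ∀ a ∈ X, a = i
    · exact key Y X hY hXne (by rwa [Finset.union_comm]) h.symm hXi
    push Not at hYi hXi
    obtain ⟨b, hb, hbi⟩ := hYi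
    obtain ⟨a, ha, hai⟩ := hXi
    exact absurd h (not_satisfies_increment hi hr hv hfreshR hr' ha
      (Finset.mem_of_mem_insert_of_ne (hX ha) hai) hb
      (Finset.mem_of_mem_insert_of_ne (hY hb) hbi))
  · rintro ⟨X, hXR, hXk, h⟩
    have hXne : X.Nonempty := Finset.card_pos.1 (by omega)
    refine ⟨X, {i}, hXR.trans (Finset.subset_insert _ _), by simp, hXne,
      Finset.singleton_nonempty i, ?_,
      (satisfies_increment_singleton_iff hi hfreshR hr' hXR hXne).2 h⟩
    rw [Finset.card_union_of_disjoint
      (Finset.disjoint_singleton_right.2 fun hiX => hi (hXR hiX)), hXk, Finset.card_singleton]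
end

section
/- Let r be a nonempty relation over index schema R ∪ {i} (i ∉ R), let I = {i_A : A ∈ R} be a set of fresh attributes disjoint from R ∪ {i}, and let 0 and 1 be two distinct values not appearing anywhere in r. Let r₀ be obtained from r by replacing each tuple t by the tuple over R ∪ I that agrees with t on R and maps i_A to t(i) for every A ∈ R; let t₀ and t₁ be the tuples over R ∪ I mapping all attributes to 0 and to 1, respectively; let r₁ = r₀ ∪ {t₀, t₁}; and let r′ = r₀ ∪ ((r₁[R] × r₁[I]) \ (r₀[R] × r₀[I])), where for projections s over R and s′ over I, s × s′ denotes the set of tuples over R ∪ I whose restriction to R lies in s and restriction to I lies in s′. Then: (a) every non-trivial independence statement X ⊥ Y satisfied by r′ has X ⊆ R and Y ⊆ I or vice versa; and (b) for every n ≥ 1, r satisfies X ⊥ {i} for some X ⊆ R with |X| = n if and only if r′ satisfies a non-trivial IS X ⊥ Y with X ⊆ R, |X| = n, and Y ⊆ I nonempty. -/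
open Classical in
theorem stmt7 {α β : Type*} [DecidableEq α]
    (R : Finset α) (i : α) (hi : i ∉ R)
    -- the fresh attributes i_A for A ∈ R, given by an injection f with fresh image I
    (f : α → α) (hfinj : Set.InjOn f R)
    (I : Finset α) (hI : I = R.image f) (hIfresh : Disjoint I (insert i R))
    (r : Finset (α → β)) (hr : r.Nonempty)
    (v₀ v₁ : β) (hv : v₀ ≠ v₁)
    (hfresh : ∀ t ∈ r, ∀ a ∈ insert i R, t a ≠ v₀ ∧ t a ≠ v₁) :
    -- r₀ : each tuple t of r is replaced by the tuple agreeing with t on R and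
    --      mapping every i_A ∈ I to t(i)
    ∀ r₀ : Finset (α → β), r₀ = r.image (fun t a => if a ∈ I then t i else t a) →
    -- r₁ = r₀ ∪ {t₀, t₁} with t₀, t₁ the all-0 and all-1 tuples
    ∀ r₁ : Finset (α → β), r₁ = insert (fun _ => v₀) (insert (fun _ => v₁) r₀) →
    -- r′ = r₀ ∪ ((r₁[R] × r₁[I]) \ (r₀[R] × r₀[I])), products encoded by combining
    -- a tuple's R-part with another tuple's I-part (junk outside R ∪ I set to v₀)
    ∀ r' : Finset (α → β), r' = r₀ ∪
      (((r₁ ×ˢ r₁).image (fun p a => if a ∈ R then p.1 a else if a ∈ I then p.2 a else v₀)) \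
       ((r₀ ×ˢ r₀).image (fun p a => if a ∈ R then p.1 a else if a ∈ I then p.2 a else v₀))) →
    -- (a) every non-trivial IS of r′ splits between R and I
    ((∀ X Y : Finset α, X ⊆ R ∪ I → Y ⊆ R ∪ I → X.Nonempty → Y.Nonempty →
        Satisfies r' X Y → (X ⊆ R ∧ Y ⊆ I) ∨ (X ⊆ I ∧ Y ⊆ R)) ∧
    -- (b) correspondence of the independence statements
     (∀ n : ℕ, 1 ≤ n →
        ((∃ X : Finset α, X ⊆ R ∧ X.card = n ∧ Satisfies r X {i}) ↔
         (∃ X Y : Finset α, X ⊆ R ∧ X.card = n ∧ Y ⊆ I ∧ Y.Nonempty ∧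
            Satisfies r' X Y)))) := by
  rintro r₀ hr₀ r₁ hr₁ r' hr'
  have hdisj : ∀ a ∈ I, a ∉ R := fun a ha haR =>
    Finset.disjoint_left.1 hIfresh ha (Finset.mem_insert_of_mem haR)
  have hIne : R.Nonempty → I.Nonempty := fun h => hI ▸ h.image f
  have hr₀_old : ∀ s ∈ r₀, ∃ t ∈ r, (∀ a ∈ R, s a = t a) ∧ (∀ a ∈ I, s a = t i) := by
    intro s hs
    rw [hr₀, Finset.mem_image] at hs
    obtain ⟨t, ht, rfl⟩ := hs
    exact ⟨t, ht, fun a ha => if_neg fun h => hdisj a h ha, fun a ha => if_pos ha⟩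
  have hr₀_new : ∀ t ∈ r, ∃ s ∈ r₀, (∀ a ∈ R, s a = t a) ∧ (∀ a ∈ I, s a = t i) := by
    intro t ht
    refine ⟨_, hr₀ ▸ Finset.mem_image_of_mem _ ht, fun a ha => if_neg fun h => hdisj a h ha,
      fun a ha => if_pos ha⟩
  have hr₀_fresh : ∀ s ∈ r₀, ∀ a ∈ R ∪ I, s a ≠ v₀ ∧ s a ≠ v₁ := by
    intro s hs a ha
    obtain ⟨t, ht, htR, htI⟩ := hr₀_old s hs
    rcases Finset.mem_union.1 ha with ha | ha
    · rw [htR a ha]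
      exact hfresh t ht a (Finset.mem_insert_of_mem ha)
    · rw [htI a ha]
      exact hfresh t ht i (Finset.mem_insert_self _ _)
  have hr₁_mem : ∀ p, p ∈ r₁ ↔ ((p = fun _ => v₀) ∨ p = fun _ => v₁) ∨ p ∈ r₀ := by
    intro p
    rw [hr₁, Finset.mem_insert, Finset.mem_insert, or_assoc]
  have hr₀_sub : ∀ s ∈ r₀, s ∈ r' := fun s hs => hr' ▸ Finset.mem_union_left _ hs
  have hr'_cases : ∀ s ∈ r', s ∈ r₀ ∨ ∃ p ∈ r₁, ∃ q ∈ r₁, (p ∉ r₀ ∨ q ∉ r₀) ∧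
      (∀ a ∈ R, s a = p a) ∧ (∀ a ∈ I, s a = q a) := by
    intro s hs
    rw [hr', Finset.mem_union, Finset.mem_sdiff, Finset.mem_image, Finset.mem_image] at hs
    rcases hs with hs | ⟨⟨⟨p, q⟩, hpq, rfl⟩, hnot⟩
    · exact Or.inl hs
    · rw [Finset.mem_product] at hpq
      refine Or.inr ⟨p, hpq.1, q, hpq.2, ?_, fun a ha => if_pos ha,
        fun a ha => (if_neg (hdisj a ha)).trans (if_pos ha)⟩
      by_contra! h
      exact hnot ⟨(p, q), Finset.mem_product.2 h, rfl⟩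
  have hr'_comb : R.Nonempty → ∀ p ∈ r₁, ∀ q ∈ r₁, (p ∉ r₀ ∨ q ∉ r₀) →
      ∃ s ∈ r', (∀ a ∈ R, s a = p a) ∧ (∀ a ∈ I, s a = q a) := by
    intro hR p hp q hq hpq
    obtain ⟨b, hb⟩ := hR
    obtain ⟨c, hc⟩ := hIne ⟨b, hb⟩
    refine ⟨fun a => if a ∈ R then p a else if a ∈ I then q a else v₀, ?_,
      fun a ha => if_pos ha, fun a ha => (if_neg (hdisj a ha)).trans (if_pos ha)⟩
    rw [hr', Finset.mem_union, Finset.mem_sdiff]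
    refine Or.inr ⟨Finset.mem_image.2 ⟨(p, q), Finset.mem_product.2 ⟨hp, hq⟩, rfl⟩, ?_⟩
    rw [Finset.mem_image]
    rintro ⟨⟨p', q'⟩, hpq', heq⟩
    rw [Finset.mem_product] at hpq'
    have hb' : p' b = p b := by simpa [hb] using congrFun heq b
    have hc' : q' c = q c := by simpa [hc, hdisj c hc] using congrFun heq c
    have hbf := hr₀_fresh p' hpq'.1 b (Finset.mem_union_left _ hb)
    have hcf := hr₀_fresh q' hpq'.2 c (Finset.mem_union_right _ hc)
    rw [hb'] at hbf
    rw [hc'] at hcf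
    rcases hpq with h | h
    · rcases (hr₁_mem p).1 hp with (rfl | rfl) | h'
      exacts [hbf.1 rfl, hbf.2 rfl, h h']
    · rcases (hr₁_mem q).1 hq with (rfl | rfl) | h'
      exacts [hcf.1 rfl, hcf.2 rfl, h h']
  have hr₁_sep : ∀ p ∈ r₁, ∀ a ∈ R ∪ I, ∀ b ∈ R ∪ I, p a = v₀ → p b = v₁ → False := by
    intro p hp a ha b _ h₀ h₁
    rcases (hr₁_mem p).1 hp with (rfl | rfl) | h
    exacts [hv h₁, hv h₀.symm, (hr₀_fresh p h a ha).1 h₀]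
  have hproj : ∀ s ∈ r', ∃ p ∈ r₁, ∃ q ∈ r₁, (∀ a ∈ R, s a = p a) ∧ (∀ a ∈ I, s a = q a) := by
    intro s hs
    rcases hr'_cases s hs with h | ⟨p, hp, q, hq, -, h⟩
    · exact ⟨s, (hr₁_mem s).2 (Or.inr h), s, (hr₁_mem s).2 (Or.inr h), fun _ _ => rfl,
        fun _ _ => rfl⟩
    · exact ⟨p, hp, q, hq, h⟩
  have hconst_notMem : R.Nonempty → ∀ v, (v = v₀ ∨ v = v₁) → (fun _ => v) ∉ r₀ := by
    rintro ⟨b, hb⟩ v hvv h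
    have := hr₀_fresh _ h b (Finset.mem_union_left _ hb)
    exact hvv.elim this.1 this.2
  refine ⟨?_, ?_⟩
  · intro X Y hX hY hXne hYne hsat
    have hR : R.Nonempty := by
      obtain ⟨a, ha⟩ := hXne
      rcases Finset.mem_union.1 (hX ha) with h | h
      · exact ⟨a, h⟩
      · rw [hI] at h
        exact Finset.image_nonempty.1 ⟨a, h⟩
    have hmem₀ : (fun _ => v₀) ∈ r₁ := (hr₁_mem _).2 (Or.inl (Or.inl rfl))
    have hmem₁ : (fun _ => v₁) ∈ r₁ := (hr₁_mem _).2 (Or.inl (Or.inr rfl))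
    obtain ⟨s₀, hs₀, h₀R, h₀I⟩ := hr'_comb hR _ hmem₀ _ hmem₀
      (Or.inl (hconst_notMem hR v₀ (Or.inl rfl)))
    obtain ⟨s₁, hs₁, h₁R, h₁I⟩ := hr'_comb hR _ hmem₁ _ hmem₁
      (Or.inl (hconst_notMem hR v₁ (Or.inr rfl)))
    obtain ⟨t, ht, htX, htY⟩ := hsat s₀ hs₀ s₁ hs₁
    obtain ⟨p, hp, q, hq, hpR, hqI⟩ := hproj t ht
    have hnotR : ∀ a ∈ X, ∀ b ∈ Y, a ∈ R → b ∈ R → False := fun a ha b hb haR hbR =>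
      hr₁_sep p hp a (hX ha) b (hY hb) (by rw [← hpR a haR, htX a ha, h₀R a haR])
        (by rw [← hpR b hbR, htY b hb, h₁R b hbR])
    have hnotI : ∀ a ∈ X, ∀ b ∈ Y, a ∈ I → b ∈ I → False := fun a ha b hb haI hbI =>
      hr₁_sep q hq a (hX ha) b (hY hb) (by rw [← hqI a haI, htX a ha, h₀I a haI])
        (by rw [← hqI b hbI, htY b hb, h₁I b hbI])
    obtain ⟨a, ha⟩ := hXne
    obtain ⟨b, hb⟩ := hYne
    rcases Finset.mem_union.1 (hX ha) with haR | haI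
    · have hYI : Y ⊆ I := fun c hc =>
        (Finset.mem_union.1 (hY hc)).resolve_left fun h => hnotR a ha c hc haR h
      exact Or.inl ⟨fun c hc => (Finset.mem_union.1 (hX hc)).resolve_right fun h =>
        hnotI c hc b hb h (hYI hb), hYI⟩
    · have hYR : Y ⊆ R := fun c hc =>
        (Finset.mem_union.1 (hY hc)).resolve_right fun h => hnotI a ha c hc haI h
      exact Or.inr ⟨fun c hc => (Finset.mem_union.1 (hX hc)).resolve_left fun h =>
        hnotR c hc b hb h (hYR hb), hYR⟩
  · intro n hn
    constructor
    · rintro ⟨X, hX, hXn, hsat⟩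
      have hR : R.Nonempty := (Finset.card_pos.1 (by omega : 0 < X.card)).mono hX
      refine ⟨X, I, hX, hXn, subset_rfl, hIne hR, fun t₁ ht₁ t₂ ht₂ => ?_⟩
      obtain ⟨p, hp, -, -, hpR, -⟩ := hproj t₁ ht₁
      obtain ⟨-, -, q, hq, -, hqI⟩ := hproj t₂ ht₂
      by_cases hpq : p ∉ r₀ ∨ q ∉ r₀
      · obtain ⟨s, hs, hsR, hsI⟩ := hr'_comb hR p hp q hq hpq
        exact ⟨s, hs, fun a ha => (hsR a (hX ha)).trans (hpR a (hX ha)).symm,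
          fun a ha => (hsI a ha).trans (hqI a ha).symm⟩
      · push Not at hpq
        obtain ⟨u₁, hu₁, hu₁R, -⟩ := hr₀_old p hpq.1
        obtain ⟨u₂, hu₂, -, hu₂I⟩ := hr₀_old q hpq.2
        obtain ⟨u, hu, huX, hui⟩ := hsat u₁ hu₁ u₂ hu₂
        obtain ⟨s, hs, hsR, hsI⟩ := hr₀_new u hu
        refine ⟨s, hr₀_sub s hs, fun a ha => ?_, fun a ha => ?_⟩
        · rw [hsR a (hX ha), huX a ha, hpR a (hX ha), hu₁R a (hX ha)]
        · rw [hsI a ha, hui i (Finset.mem_singleton_self i), hqI a ha, hu₂I a ha]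
    · rintro ⟨X, Y, hX, hXn, hY, ⟨b, hb⟩, hsat⟩
      refine ⟨X, hX, hXn, fun u₁ hu₁ u₂ hu₂ => ?_⟩
      obtain ⟨c, hc⟩ : X.Nonempty := Finset.card_pos.1 (by omega)
      obtain ⟨s₁, hs₁, hs₁R, -⟩ := hr₀_new u₁ hu₁
      obtain ⟨s₂, hs₂, -, hs₂I⟩ := hr₀_new u₂ hu₂
      obtain ⟨s, hs, hsX, hsY⟩ := hsat s₁ (hr₀_sub s₁ hs₁) s₂ (hr₀_sub s₂ hs₂)
      have hsr₀ : s ∈ r₀ := by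
        rcases hr'_cases s hs with h | ⟨p, hp, q, hq, hpq, hpR, hqI⟩
        · exact h
        · have hcf := hr₀_fresh s₁ hs₁ c (Finset.mem_union_left _ (hX hc))
          have hbf := hr₀_fresh s₂ hs₂ b (Finset.mem_union_right _ (hY hb))
          rw [← hsX c hc, hpR c (hX hc)] at hcf
          rw [← hsY b hb, hqI b (hY hb)] at hbf
          exfalso
          rcases hpq with h | h
          · rcases (hr₁_mem p).1 hp with (rfl | rfl) | h'
            exacts [hcf.1 rfl, hcf.2 rfl, h h']
          · rcases (hr₁_mem q).1 hq with (rfl | rfl) | h'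
            exacts [hbf.1 rfl, hbf.2 rfl, h h']
      obtain ⟨u, hu, huR, huI⟩ := hr₀_old s hsr₀
      refine ⟨u, hu, fun a ha => ?_, fun a ha => ?_⟩
      · rw [← huR a (hX ha), hsX a ha, hs₁R a (hX ha)]
      · rw [Finset.mem_singleton.1 ha, ← huI b (hY hb), hsY b hb, hs₂I b (hY hb)]
end

section
/- Let r₁, …, r_n be index relations over a shared index schema R ∪ {i} such that for j ≠ k, the set of values appearing anywhere in r_j (including the index column) is disjoint from the set of values appearing anywhere in r_k. Let r = ⋃_{j=1}^n r_j ∪ ⋃_{j=1}^n (r_j[R] × ⋃_{k≠j} r_k[{i}]), where s × s′ denotes the set of tuples over R ∪ {i} whose restriction to R lies in s and whose i-value lies in s′. Then for every nonempty X ⊆ R: r satisfies X ⊥ {i} if and only if every r_j (1 ≤ j ≤ n) satisfies X ⊥ {i}. -/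
open Classical in
theorem stmt8 {α β : Type*} [DecidableEq α]
    (R : Finset α) (i : α) (hi : i ∉ R)
    (n : ℕ) (hn : 1 ≤ n) (rels : Fin n → Finset (α → β))
    -- distinct relations share no values (on the columns of the index schema)
    (hdisj : ∀ j k : Fin n, j ≠ k →
      ∀ t ∈ rels j, ∀ a ∈ insert i R, ∀ t' ∈ rels k, ∀ b ∈ insert i R, t a ≠ t' b) :
    -- r = ⋃ⱼ rⱼ ∪ ⋃ⱼ (rⱼ[R] × ⋃_{k ≠ j} r_k[{i}])
    ∀ r : Finset (α → β),
      r = (Finset.univ.biUnion rels) ∪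
          (Finset.univ.biUnion (fun j => Finset.univ.biUnion (fun k =>
            if k = j then ∅ else
              ((rels j ×ˢ rels k).image (fun p a => if a = i then p.2 i else p.1 a))))) →
    ∀ X : Finset α, X ⊆ R → X.Nonempty →
      (Satisfies r X {i} ↔ ∀ j : Fin n, Satisfies (rels j) X {i}) := by
  intro r hr X hX hXne
  have hsub : ∀ j, ∀ t ∈ rels j, t ∈ r := fun j t ht => by
    rw [hr]
    exact Finset.mem_union_left _ (Finset.mem_biUnion.2 ⟨j, Finset.mem_univ _, ht⟩)
  have hmix : ∀ j k, k ≠ j → ∀ p ∈ rels j, ∀ q ∈ rels k,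
      (fun a => if a = i then q i else p a) ∈ r := fun j k hkj p hp q hq => by
    rw [hr]
    refine Finset.mem_union_right _ (Finset.mem_biUnion.2 ⟨j, Finset.mem_univ _,
      Finset.mem_biUnion.2 ⟨k, Finset.mem_univ _, ?_⟩⟩)
    rw [if_neg hkj]
    exact Finset.mem_image.2 ⟨(p, q), Finset.mem_product.2 ⟨hp, hq⟩, rfl⟩
  have hne : ∀ a ∈ R, a ≠ i := fun a ha h => hi (h ▸ ha)
  -- every tuple of `r` takes its `R`-part from one relation and its index from one relation
  have hsplit : ∀ t ∈ r, ∃ j, ∃ p ∈ rels j, ∃ k, ∃ q ∈ rels k,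
      (∀ a ∈ R, t a = p a) ∧ t i = q i ∧ (k = j → t ∈ rels j) := by
    intro t ht
    rw [hr, Finset.mem_union] at ht
    rcases ht with ht | ht
    · obtain ⟨j, -, hj⟩ := Finset.mem_biUnion.1 ht
      exact ⟨j, t, hj, j, t, hj, fun _ _ => rfl, rfl, fun _ => hj⟩
    · obtain ⟨j, -, ht⟩ := Finset.mem_biUnion.1 ht
      obtain ⟨k, -, ht⟩ := Finset.mem_biUnion.1 ht
      by_cases hkj : k = j
      · simp [hkj] at ht
      · rw [if_neg hkj] at ht
        obtain ⟨⟨p, q⟩, hpq, rfl⟩ := Finset.mem_image.1 ht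
        obtain ⟨hp, hq⟩ := Finset.mem_product.1 hpq
        exact ⟨j, p, hp, k, q, hq, fun a ha => if_neg (hne a ha), if_pos rfl,
          fun h => absurd h hkj⟩
  constructor
  · intro h j t₁ h₁ t₂ h₂
    obtain ⟨t, ht, htX, hti⟩ := h t₁ (hsub j t₁ h₁) t₂ (hsub j t₂ h₂)
    obtain ⟨j', p, hp, k, q, hq, htp, htq, hjk⟩ := hsplit t ht
    obtain ⟨a, ha⟩ := hXne
    have haR := Finset.mem_insert_of_mem (b := i) (hX ha)
    have hiR := Finset.mem_insert_self i R
    have hj' : j' = j := by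
      by_contra hcon
      exact hdisj j' j hcon p hp a haR t₁ h₁ a haR ((htp a (hX ha)).symm.trans (htX a ha))
    have hk : k = j := by
      by_contra hcon
      exact hdisj k j hcon q hq i hiR t₂ h₂ i hiR
        (htq.symm.trans (hti i (Finset.mem_singleton_self i)))
    exact ⟨t, hj' ▸ hjk (hk.trans hj'.symm), htX, hti⟩
  · intro h t₁ h₁ t₂ h₂
    obtain ⟨j, p, hp, -, -, -, htp, -, -⟩ := hsplit t₁ h₁
    obtain ⟨-, -, -, k, q, hq, -, htq, -⟩ := hsplit t₂ h₂
    by_cases hkj : k = j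
    · subst hkj
      obtain ⟨t, ht, htX, hti⟩ := h k p hp q hq
      refine ⟨t, hsub k t ht, fun a ha => (htX a ha).trans (htp a (hX ha)).symm, fun a ha => ?_⟩
      rw [hti a ha, Finset.mem_singleton.1 ha, htq]
    · refine ⟨_, hmix j k hkj p hp q hq, fun a ha => ?_, fun a ha => ?_⟩
      · exact (if_neg (hne a (hX ha))).trans (htp a (hX ha)).symm
      · rw [Finset.mem_singleton.1 ha, htq]
        exact if_pos rfl
end

section
/- Let X be a finite set of variables and let c₁, …, c_m (m ≥ 1) be finite subsets of X, representing an antimonotone DNF formula φ = ⋁_{j=1}^m ⋀_{x ∈ c_j} ¬x; a set Y ⊆ X of variables assigned true satisfies φ if and only if Y ∩ c_j = ∅ for some j. Then there exists an index relation r over the index schema X ∪ {i}, of size at most m + m³, such that for every Y ⊆ X: r satisfies Y ⊥ {i} if and only if Y ∩ c_j = ∅ for some j ∈ {1, …, m}. -/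
/-- The tuple with value `v` at the index `i` that is the indicator function of `S` elsewhere. -/
def indicatorTuple {α : Type*} [DecidableEq α] (i : α) (S : Finset α) (v : ℕ) : α → ℕ :=
  fun a => if a = i then v else if a ∈ S then 1 else 0

lemma indicatorTuple_index {α : Type*} [DecidableEq α] (i : α) (S : Finset α) (v : ℕ) :
    indicatorTuple i S v i = v := by
  simp [indicatorTuple]

lemma indicatorTuple_eq_empty_iff {α : Type*} [DecidableEq α] {i : α} {S Y : Finset α}
    (hY : i ∉ Y) (v w : ℕ) :
    (∀ a ∈ Y, indicatorTuple i S v a = indicatorTuple i ∅ w a) ↔ Y ∩ S = ∅ := by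
  have h : ∀ a ∈ Y, a ≠ i := fun a ha e => hY (e ▸ ha)
  rw [← Finset.disjoint_iff_inter_eq_empty, Finset.disjoint_left]
  refine forall₂_congr fun a ha => ?_
  simp [indicatorTuple, h a ha]

lemma indicatorTuple_congr_index {α : Type*} [DecidableEq α] {i : α} {Y : Finset α}
    (hY : i ∉ Y) (S : Finset α) (v w : ℕ) :
    ∀ a ∈ Y, indicatorTuple i S v a = indicatorTuple i S w a := by
  intro a ha
  have h : a ≠ i := fun e => hY (e ▸ ha)
  simp [indicatorTuple, h]

/-- Two one-tuple index groups, containing the zero tuple and the indicator of `S`, agree on `Y`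
exactly when `Y` avoids `S`. -/
lemma satisfies_pair_iff {α : Type*} [DecidableEq α] [DecidableEq (α → ℕ)]
    {i : α} {S Y : Finset α} (hY : i ∉ Y) :
    Satisfies {indicatorTuple i ∅ 0, indicatorTuple i S 1} Y {i} ↔ Y ∩ S = ∅ := by
  rw [← indicatorTuple_eq_empty_iff hY 1 0]
  simp only [Satisfies, Finset.mem_insert, Finset.mem_singleton, forall_eq_or_imp, forall_eq,
    exists_eq_or_imp, exists_eq_left, indicatorTuple_index]
  simp +contextual [eq_comm]

/-- If index group `1` holds the indicators of all `c j`, and index group `0` holds in addition the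
zero tuple, then the groups agree on `Y` exactly when `Y` avoids some `c j`. -/
lemma satisfies_insert_image_iff {α ι : Type*} [DecidableEq α] [Fintype ι] [Nonempty ι]
    [DecidableEq (α → ℕ)] {i : α} {Y : Finset α} (hY : i ∉ Y) (c : ι → Finset α) :
    Satisfies (insert (indicatorTuple i ∅ 0)
      (Finset.univ.image (fun j => indicatorTuple i (c j) 0) ∪
        Finset.univ.image (fun j => indicatorTuple i (c j) 1))) Y {i} ↔
      ∃ j, Y ∩ c j = ∅ := by
  simp only [Satisfies, Finset.mem_insert, Finset.mem_union, Finset.mem_image, Finset.mem_univ,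
    true_and, Finset.mem_singleton, forall_eq]
  constructor
  · intro h
    obtain ⟨k⟩ := ‹Nonempty ι›
    obtain ⟨t, ht, htY, hti⟩ := h _ (Or.inl rfl) _ (Or.inr (Or.inr ⟨k, rfl⟩))
    rcases ht with rfl | ⟨j, rfl⟩ | ⟨j, rfl⟩
    · simp [indicatorTuple_index] at hti
    · simp [indicatorTuple_index] at hti
    · exact ⟨j, (indicatorTuple_eq_empty_iff hY _ _).1 htY⟩
  · rintro ⟨k, hk⟩ t₁ h₁ t₂ h₂
    have hv : t₂ i = 0 ∨ t₂ i = 1 := by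
      rcases h₂ with rfl | ⟨j, rfl⟩ | ⟨j, rfl⟩ <;> simp [indicatorTuple_index]
    have hj : ∃ j, ∀ v, ∀ a ∈ Y, indicatorTuple i (c j) v a = t₁ a := by
      rcases h₁ with rfl | ⟨j, rfl⟩ | ⟨j, rfl⟩
      · exact ⟨k, fun v => (indicatorTuple_eq_empty_iff hY _ _).2 hk⟩
      · exact ⟨j, fun v => indicatorTuple_congr_index hY _ _ _⟩
      · exact ⟨j, fun v => indicatorTuple_congr_index hY _ _ _⟩
    obtain ⟨j, hj⟩ := hj
    rcases hv with hv | hv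
    · exact ⟨_, Or.inr (Or.inl ⟨j, rfl⟩), hj 0, by rw [indicatorTuple_index, hv]⟩
    · exact ⟨_, Or.inr (Or.inr ⟨j, rfl⟩), hj 1, by rw [indicatorTuple_index, hv]⟩

theorem stmt9 {α : Type*} [DecidableEq α]
    (X : Finset α) (i : α) (hi : i ∉ X)
    (m : ℕ) (hm : 1 ≤ m) (c : Fin m → Finset α) (hc : ∀ j, c j ⊆ X) :
    ∃ r : Finset (α → ℕ), r.card ≤ m + m ^ 3 ∧
      ∀ Y : Finset α, Y ⊆ X →
        (Satisfies r Y {i} ↔ ∃ j : Fin m, Y ∩ c j = ∅) := by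
  classical
  obtain rfl | hm2 : m = 1 ∨ 2 ≤ m := by omega
  · refine ⟨{indicatorTuple i ∅ 0, indicatorTuple i (c 0) 1}, Finset.card_le_two, fun Y hYX => ?_⟩
    rw [Fin.exists_fin_one]
    exact satisfies_pair_iff (fun h => hi (hYX h))
  · have : Nonempty (Fin m) := ⟨⟨0, hm⟩⟩
    refine ⟨_, ?_, fun Y hYX => satisfies_insert_image_iff (fun h => hi (hYX h)) c⟩
    have hcard (v : ℕ) :
        (Finset.univ.image (fun j => indicatorTuple i (c j) v)).card ≤ m :=
      Finset.card_image_le.trans_eq (Finset.card_fin m)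
    have hcube : m + 1 ≤ m ^ 3 := by nlinarith [Nat.pow_le_pow_left hm2 2, pow_succ m 2]
    have hinsert := Finset.card_insert_le (indicatorTuple i ∅ 0)
      (Finset.univ.image (fun j => indicatorTuple i (c j) 0) ∪
        Finset.univ.image (fun j => indicatorTuple i (c j) 1))
    have hunion := Finset.card_union_le (Finset.univ.image (fun j => indicatorTuple i (c j) 0))
      (Finset.univ.image (fun j => indicatorTuple i (c j) 1))
    have h0 := hcard 0
    have h1 := hcard 1
    omega
end

section
/- The exchange rule is sound for independence statements in database relations: if a relation r over schema R satisfies both X ⊥ Y and (X ∪ Y) ⊥ Z, then r satisfies X ⊥ (Y ∪ Z). -/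
theorem stmt11 {α β : Type*} [DecidableEq α] (R : Finset α) (r : Finset (α → β))
    (X Y Z : Finset α) (hX : X ⊆ R) (hY : Y ⊆ R) (hZ : Z ⊆ R)
    (h₁ : Satisfies r X Y) (h₂ : Satisfies r (X ∪ Y) Z) :
    Satisfies r X (Y ∪ Z) := by
  intro t₁ ht₁ t₂ ht₂
  obtain ⟨u, hu, huX, huY⟩ := h₁ t₁ ht₁ t₂ ht₂
  obtain ⟨v, hv, hvXY, hvZ⟩ := h₂ u hu t₂ ht₂
  refine ⟨v, hv, fun a ha => ?_, fun a ha => ?_⟩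
  · exact (hvXY a (Finset.mem_union_left Y ha)).trans (huX a ha)
  · rcases Finset.mem_union.mp ha with haY | haZ
    · exact (hvXY a (Finset.mem_union_right X haY)).trans (huY a haY)
    · exact hvZ a haZ
end

section
/- Let r be a relation over schema R and let 2 ≤ k ≤ l. If r satisfies some non-trivial independence statement of arity l, then r satisfies some non-trivial independence statement of arity exactly k. -/
theorem stmt14 {α β : Type*} [DecidableEq α] (R : Finset α) (r : Finset (α → β))
    (k l : ℕ) (hk : 2 ≤ k) (hkl : k ≤ l)
    (h : ∃ X Y : Finset α, X ⊆ R ∧ Y ⊆ R ∧ X.Nonempty ∧ Y.Nonempty ∧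
      (X ∪ Y).card = l ∧ Satisfies r X Y) :
    ∃ X Y : Finset α, X ⊆ R ∧ Y ⊆ R ∧ X.Nonempty ∧ Y.Nonempty ∧
      (X ∪ Y).card = k ∧ Satisfies r X Y := by
  obtain ⟨X, Y, hX, hY, ⟨x, hx⟩, ⟨y, hy⟩, hl, hsat⟩ := h
  have hsub : ({x, y} : Finset α) ⊆ X ∪ Y := by
    intro a ha
    grind
  obtain ⟨Z, hxyZ, hZ, hcard⟩ := Finset.exists_subsuperset_card_eq hsub
    (Finset.card_le_two.trans hk) (hkl.trans_eq hl.symm)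
  refine ⟨X ∩ Z, Y ∩ Z, Finset.inter_subset_left.trans hX, Finset.inter_subset_left.trans hY,
    ⟨x, Finset.mem_inter.2 ⟨hx, hxyZ (by simp)⟩⟩, ⟨y, Finset.mem_inter.2 ⟨hy, hxyZ (by simp)⟩⟩,
    ?_, ?_⟩
  · rw [← Finset.union_inter_distrib_right, Finset.inter_eq_right.2 hZ, hcard]
  · intro t₁ h₁ t₂ h₂
    obtain ⟨t, ht, htX, htY⟩ := hsat t₁ h₁ t₂ h₂
    exact ⟨t, ht, fun a ha => htX a (Finset.mem_inter.1 ha).1,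
      fun a ha => htY a (Finset.mem_inter.1 ha).1⟩
end
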